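/- Let k be an algebraically closed field and a, c, B, C ∈ k. Let T = T(a, (1-a)(2-B), c, -1, 0, 1; 1, B, C, 0, -1, 0). Then the family (i,j,l) ↦ y^i·x^j·z^l (for i, j, l ≥ 0) is a k-vector-space basis of T; in particular T is a graded twisted tensor product of k[x,y] and k[z] and its Hilbert series is (1-t)^{-3}. -/

import Mathlib

noncomputable section

open FreeAlgebra

/-- The generator `x` of the free algebra `k⟨x,y,z⟩`. -/
def Xf (k : Type*) [Field k] : FreeAlgebra k (Fin 3) := FreeAlgebra.ι k 0

/-- The generator `y` of the free algebra `k⟨x,y,z⟩`. -/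
def Yf (k : Type*) [Field k] : FreeAlgebra k (Fin 3) := FreeAlgebra.ι k 1

/-- The generator `z` of the free algebra `k⟨x,y,z⟩`. -/
def Zf (k : Type*) [Field k] : FreeAlgebra k (Fin 3) := FreeAlgebra.ι k 2

/-- The relations defining `T(a,b,c,d,e,f; A,B,C,D,E,F)`: `xy = yx`,
`zx = a·x² + b·xy + c·y² + d·xz + e·yz + f·z²`, and
`zy = A·x² + B·xy + C·y² + D·xz + E·yz + F·z²`. -/
def Trel (k : Type*) [Field k] (a b c d e f A B C D E F : k) :
    FreeAlgebra k (Fin 3) → FreeAlgebra k (Fin 3) → Prop := fun m n =>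
  (m = Xf k * Yf k ∧ n = Yf k * Xf k) ∨
  (m = Zf k * Xf k ∧
    n = a • (Xf k) ^ 2 + b • (Xf k * Yf k) + c • (Yf k) ^ 2 +
        d • (Xf k * Zf k) + e • (Yf k * Zf k) + f • (Zf k) ^ 2) ∨
  (m = Zf k * Yf k ∧
    n = A • (Xf k) ^ 2 + B • (Xf k * Yf k) + C • (Yf k) ^ 2 +
        D • (Xf k * Zf k) + E • (Yf k * Zf k) + F • (Zf k) ^ 2)

/-- The algebra `T(a,b,c,d,e,f; A,B,C,D,E,F)`. -/
abbrev Talg (k : Type*) [Field k] (a b c d e f A B C D E F : k) :=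
  RingQuot (Trel k a b c d e f A B C D E F)

/-- The image of `x` in `T`. -/
def Tx (k : Type*) [Field k] (a b c d e f A B C D E F : k) :
    Talg k a b c d e f A B C D E F :=
  RingQuot.mkAlgHom k (Trel k a b c d e f A B C D E F) (Xf k)

/-- The image of `y` in `T`. -/
def Ty (k : Type*) [Field k] (a b c d e f A B C D E F : k) :
    Talg k a b c d e f A B C D E F :=
  RingQuot.mkAlgHom k (Trel k a b c d e f A B C D E F) (Yf k)

/-- The image of `z` in `T`. -/
def Tz (k : Type*) [Field k] (a b c d e f A B C D E F : k) :
    Talg k a b c d e f A B C D E F :=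
  RingQuot.mkAlgHom k (Trel k a b c d e f A B C D E F) (Zf k)

/-- The property that the family `(i,j,l) ↦ y^i x^j z^l` is a `k`-vector-space basis of `T`;
following the paper, this is exactly the condition that `T` is a graded twisted tensor
product of `k[x,y]` and `k[z]`. -/
def ThasBasis (k : Type*) [Field k] (a b c d e f A B C D E F : k) : Prop :=
  LinearIndependent k
      (fun p : ℕ × ℕ × ℕ =>
        (Ty k a b c d e f A B C D E F) ^ p.1 * (Tx k a b c d e f A B C D E F) ^ p.2.1 *
          (Tz k a b c d e f A B C D E F) ^ p.2.2) ∧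
    Submodule.span k
      (Set.range fun p : ℕ × ℕ × ℕ =>
        (Ty k a b c d e f A B C D E F) ^ p.1 * (Tx k a b c d e f A B C D E F) ^ p.2.1 *
          (Tz k a b c d e f A B C D E F) ^ p.2.2) = ⊤

section Representation

variable {k P : Type*} [Field k] [CommRing P] [Algebra k P]

/-- Multiplication by `y` on the free module with basis `1, y, x, xy`, where `y² = s`. -/
def fiberY (s : P) : Module.End k (P × P × P × P) where
  toFun h := (s * h.2.1, h.1, s * h.2.2.2, h.2.2.1)
  map_add' _ _ := by simp [mul_add]
  map_smul' _ _ := by simp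

/-- Multiplication by `x` on the free module with basis `1, y, x, xy`, where `y² = s` and
`x² = r - β xy`. -/
def fiberX (β : k) (s r : P) : Module.End k (P × P × P × P) where
  toFun h := (r * h.2.2.1, r * h.2.2.2, h.1 - β • (s * h.2.2.2), h.2.1 - β • h.2.2.1)
  map_add' _ _ := by
    ext <;> simp [Algebra.smul_def] <;> ring
  map_smul' _ _ := by
    ext <;> simp [Algebra.smul_def] <;> ring

/-- The automorphism `y ↦ -y` on the free module with basis `1, y, x, xy`. -/
def fiberSign : Module.End k (P × P × P × P) where
  toFun h := (h.1, -h.2.1, h.2.2.1, -h.2.2.2)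
  map_add' _ _ := by
    ext <;> simp <;> ring
  map_smul' _ _ := by simp

/-- The skew derivation `y ↦ q` on the free module with basis `1, y, x, xy`. -/
def fiberDer (q : P) : Module.End k (P × P × P × P) where
  toFun h := (q * h.2.1, 0, q * h.2.2.2, 0)
  map_add' _ _ := by simp [mul_add]
  map_smul' _ _ := by simp

/-- Specialization of the basis `1, y, x, xy` at a point `(x₀, y₀)`. -/
def fiberEval (x₀ y₀ : P) : (P × P × P × P) →ₗ[k] P where
  toFun h := h.1 + y₀ * h.2.1 + x₀ * h.2.2.1 + x₀ * y₀ * h.2.2.2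
  map_add' _ _ := by simp; ring
  map_smul' _ _ := by simp [Algebra.smul_def]; ring

/-- Right multiplication by `y` on the module spanned by the alternating words
`1, u, ux, uxu, …`. -/
def wordY (s : P) : Module.End k (ℕ → P × P × P × P) where
  toFun m n := fiberY (k := k) s (m n)
  map_add' _ _ := by ext1; simp
  map_smul' _ _ := by ext1; simp

/-- Right multiplication by `x` on the module spanned by the alternating words
`1, u, ux, uxu, …`. -/
def wordX (β : k) (s r : P) : Module.End k (ℕ → P × P × P × P) where
  toFun m
    | 0 => fiberX β s r (m 0)
    | n + 1 => if Even n then r • m (n + 2) else m n - β • fiberY (k := k) s (m (n + 1))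
  map_add' _ _ := by
    ext1 n
    rcases n with _ | n
    · simp
    · by_cases h : Even n <;> simp [h]
      abel
  map_smul' c _ := by
    ext1 n
    rcases n with _ | n
    · simp
    · by_cases h : Even n
      · simp [h, smul_comm c]
      · simp [h, smul_sub, smul_comm c]

/-- Right multiplication by `u` on the module spanned by the alternating words
`1, u, ux, uxu, …`, where `u² = γ s` and `yu = -uy + q`. -/
def wordU (γ : k) (s q : P) : Module.End k (ℕ → P × P × P × P) where
  toFun m
    | 0 => γ • s • fiberSign (k := k) (m 1) + fiberDer (k := k) q (m 0)
    | n + 1 =>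
      if Even n then fiberSign (k := k) (m n) + fiberDer (k := k) q (m (n + 1))
      else γ • s • fiberSign (k := k) (m (n + 2)) + fiberDer (k := k) q (m (n + 1))
  map_add' _ _ := by
    ext1 n
    rcases n with _ | n
    · simp; abel
    · by_cases h : Even n <;> simp [h] <;> abel
  map_smul' c _ := by
    ext1 n
    rcases n with _ | n
    · simp [smul_comm c]
    · by_cases h : Even n <;> simp [h, smul_comm c]

theorem wordY_apply (s : P) (m : ℕ → P × P × P × P) (n : ℕ) :
    wordY (k := k) s m n = fiberY (k := k) s (m n) :=
  rfl

theorem wordX_zero (β : k) (s r : P) (m : ℕ → P × P × P × P) :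
    wordX β s r m 0 = fiberX β s r (m 0) :=
  rfl

theorem wordX_succ (β : k) (s r : P) (m : ℕ → P × P × P × P) (n : ℕ) :
    wordX β s r m (n + 1) =
      if Even n then r • m (n + 2) else m n - β • fiberY (k := k) s (m (n + 1)) :=
  rfl

theorem wordU_zero (γ : k) (s q : P) (m : ℕ → P × P × P × P) :
    wordU γ s q m 0 = γ • s • fiberSign (k := k) (m 1) + fiberDer (k := k) q (m 0) :=
  rfl

theorem wordU_succ (γ : k) (s q : P) (m : ℕ → P × P × P × P) (n : ℕ) :
    wordU γ s q m (n + 1) =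
      if Even n then fiberSign (k := k) (m n) + fiberDer (k := k) q (m (n + 1))
      else γ • s • fiberSign (k := k) (m (n + 2)) + fiberDer (k := k) q (m (n + 1)) :=
  rfl

theorem wordX_mul_wordY (β : k) (s r : P) :
    wordX β s r * wordY s = wordY s * wordX β s r := by
  refine LinearMap.ext fun m => funext fun n => ?_
  rcases n with _ | n
  · ext <;> simp [wordX_zero, wordY_apply, fiberX, fiberY, Algebra.smul_def] <;> ring
  · by_cases h : Even n <;> ext <;>
      simp [wordX_succ, wordY_apply, fiberY, h, Algebra.smul_def] <;> ring

theorem wordU_mul_wordU (γ : k) (s q : P) :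
    wordU γ s q * wordU γ s q = γ • (wordY s * wordY s) := by
  refine LinearMap.ext fun m => funext fun n => ?_
  rcases n with _ | _ | n
  · ext <;> simp [wordU_zero, wordU_succ, wordY_apply, fiberSign, fiberDer, fiberY,
      Algebra.smul_def] <;> ring
  · ext <;> simp [wordU_zero, wordU_succ, wordY_apply, fiberSign, fiberDer, fiberY,
      Algebra.smul_def]
  · by_cases h : Even n <;> ext <;>
      simp [wordU_succ, wordY_apply, fiberSign, fiberDer, fiberY, h, Nat.even_add_one,
        Algebra.smul_def, -Nat.not_even_iff_odd] <;> ring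

theorem wordU_mul_wordY_add (β γ δ : k) (s q : P) :
    wordU γ s q * wordY s + wordY s * wordU γ s q =
      wordX β s (q - δ • s) * wordX β s (q - δ • s) +
        β • (wordX β s (q - δ • s) * wordY s) + δ • (wordY s * wordY s) := by
  refine LinearMap.ext fun m => funext fun n => ?_
  rcases n with _ | _ | n
  · ext <;> simp [wordU_zero, wordX_zero, wordY_apply, fiberSign, fiberDer, fiberX, fiberY,
      Algebra.smul_def] <;> ring
  · ext <;> simp [wordU_succ, wordX_succ, wordY_apply, fiberSign, fiberDer, fiberY,
      Algebra.smul_def] <;> ring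
  · by_cases h : Even n <;> ext <;>
      simp [wordU_succ, wordX_succ, wordY_apply, fiberSign, fiberDer, fiberY, h,
        Nat.even_add_one, Algebra.smul_def, -Nat.not_even_iff_odd] <;> ring

theorem fiberSign_fiberSign (h : P × P × P × P) :
    fiberSign (k := k) (fiberSign (k := k) h) = h := by
  simp [fiberSign]

/-- Right multiplication by `z = u + x + α y`. -/
def wordZ (α β γ : k) (s q r : P) : Module.End k (ℕ → P × P × P × P) :=
  wordU γ s q + wordX β s r + α • wordY s

theorem wordZ_succ (α β γ : k) (s q r : P) (m : ℕ → P × P × P × P) (n : ℕ) :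
    wordZ α β γ s q r m (n + 1) =
      (if Even n then fiberSign (k := k) (m n) + fiberDer (k := k) q (m (n + 1))
        else γ • s • fiberSign (k := k) (m (n + 2)) + fiberDer (k := k) q (m (n + 1))) +
      (if Even n then r • m (n + 2) else m n - β • fiberY (k := k) s (m (n + 1))) +
      α • fiberY (k := k) s (m (n + 1)) :=
  rfl

theorem wordZ_pow_apply_eq_zero (α β γ : k) (s q r : P) (h : P × P × P × P) (l : ℕ) :
    ∀ n, l < n → (wordZ α β γ s q r ^ l) (Pi.single 0 h) n = 0 := by
  induction l with
  | zero => intro n hn; simp [hn.ne']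
  | succ l ih =>
    intro n hn
    obtain ⟨n, rfl⟩ : ∃ n', n = n' + 1 := ⟨n - 1, by omega⟩
    have h0 := ih n (by omega)
    have h1 := ih (n + 1) (by omega)
    have h2 := ih (n + 2) (by omega)
    rw [pow_succ', Module.End.mul_apply]
    by_cases he : Even n <;> simp [wordZ_succ, he, h0, h1, h2]

theorem exists_leftInverse_wordZ_pow (α β γ : k) (s q r : P) (l : ℕ) :
    ∃ θ : Module.End k (P × P × P × P), ∀ h,
      θ ((wordZ α β γ s q r ^ l) (Pi.single 0 h) l) = h := by
  induction l with
  | zero => exact ⟨1, by simp⟩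
  | succ l ih =>
    obtain ⟨θ, hθ⟩ := ih
    have h1 := fun h => wordZ_pow_apply_eq_zero α β γ s q r h l (l + 1) (by omega)
    have h2 := fun h => wordZ_pow_apply_eq_zero α β γ s q r h l (l + 2) (by omega)
    by_cases he : Even l
    · refine ⟨θ * fiberSign, fun h => ?_⟩
      rw [pow_succ', Module.End.mul_apply]
      simp [wordZ_succ, he, h1, h2, fiberSign_fiberSign, hθ]
    · refine ⟨θ, fun h => ?_⟩
      rw [pow_succ', Module.End.mul_apply]
      simp [wordZ_succ, he, h1, h2, hθ]

theorem wordY_pow_single (s : P) (h : P × P × P × P) (i : ℕ) :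
    (wordY (k := k) s ^ i) (Pi.single 0 h) = Pi.single 0 ((fiberY (k := k) s ^ i) h) := by
  induction i with
  | zero => simp
  | succ i ih =>
    rw [pow_succ', Module.End.mul_apply, ih, pow_succ', Module.End.mul_apply]
    ext1 n
    rcases n with _ | n <;> simp [wordY]

theorem wordX_pow_single (β : k) (s r : P) (h : P × P × P × P) (j : ℕ) :
    (wordX β s r ^ j) (Pi.single 0 h) = Pi.single 0 ((fiberX β s r ^ j) h) := by
  induction j with
  | zero => simp
  | succ j ih =>
    rw [pow_succ', Module.End.mul_apply, ih, pow_succ', Module.End.mul_apply]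
    ext1 n
    rcases n with _ | n
    · simp [wordX]
    · by_cases he : Even n
      · simp [wordX, he]
      · have hn : n ≠ 0 := by rintro rfl; simp at he
        simp [wordX, he, hn]

theorem fiberEval_fiberY_pow (x₀ y₀ : P) (h : P × P × P × P) (i : ℕ) :
    fiberEval (k := k) x₀ y₀ ((fiberY (k := k) (y₀ ^ 2) ^ i) h) =
      y₀ ^ i * fiberEval (k := k) x₀ y₀ h := by
  induction i with
  | zero => simp
  | succ i ih =>
    rw [pow_succ' (fiberY _), Module.End.mul_apply, pow_succ' y₀ i, mul_assoc, ← ih]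
    simp [fiberEval, fiberY]
    ring

theorem fiberEval_fiberX_pow (β : k) (x₀ y₀ : P) (h : P × P × P × P) (j : ℕ) :
    fiberEval (k := k) x₀ y₀ ((fiberX β (y₀ ^ 2) (x₀ ^ 2 + β • (x₀ * y₀)) ^ j) h) =
      x₀ ^ j * fiberEval (k := k) x₀ y₀ h := by
  induction j with
  | zero => simp
  | succ j ih =>
    rw [pow_succ' (fiberX _ _ _), Module.End.mul_apply, pow_succ' x₀ j, mul_assoc, ← ih]
    simp [fiberEval, fiberX, Algebra.smul_def]
    ring

end Representation

/-- A family which is block triangular with respect to a sequence of linear maps, with linearly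
independent diagonal blocks, is linearly independent. -/
theorem linearIndependent_of_blockTriangular {k ι M N : Type*} [Ring k] [AddCommGroup M]
    [Module k M] [AddCommGroup N] [Module k N] {g : ι → M} (d : ι → ℕ) (Θ : ℕ → M →ₗ[k] N)
    (hzero : ∀ p n, d p < n → Θ n (g p) = 0)
    (hdiag : ∀ l, LinearIndepOn k (fun p => Θ l (g p)) {p | d p = l}) :
    LinearIndependent k g := by
  classical
  rw [linearIndependent_iff']
  intro t c hc
  by_contra! hne
  obtain ⟨p₁, hp₁, hcp₁⟩ := hne
  obtain ⟨p₀, hp₀, hmax⟩ := (t.filter fun p => c p ≠ 0).exists_max_image d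
    ⟨p₁, by simp [hp₁, hcp₁]⟩
  simp only [Finset.mem_filter] at hp₀ hmax
  refine hp₀.2 (linearIndepOn_iff'.1 (hdiag (d p₀)) (t.filter fun p => d p = d p₀) c
    (fun p hp => by simpa using (Finset.mem_filter.1 hp).2) ?_ p₀ (by simp [hp₀.1]))
  rw [Finset.sum_filter_of_ne]
  · simpa using congrArg (Θ (d p₀)) hc
  · intro p hp hpne
    by_contra hd
    rcases lt_or_gt_of_ne hd with hlt | hgt
    · exact hpne (by rw [hzero p _ hlt, smul_zero])
    · refine hpne ?_
      have : c p = 0 := by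
        by_contra h
        exact absurd (hmax p ⟨hp, h⟩) (by omega)
      rw [this, zero_smul]

section Spanning

/-- The span of the monomials `y^i x^j z^l`. -/
def monomialSpan (k : Type*) {T : Type*} [Field k] [Ring T] [Algebra k T] (x y z : T) :
    Submodule k T :=
  Submodule.span k (Set.range fun p : ℕ × ℕ × ℕ => y ^ p.1 * x ^ p.2.1 * z ^ p.2.2)

variable {k T : Type*} [Field k] [Ring T] [Algebra k T]

theorem monomial_mem_monomialSpan (x y z : T) (i j l : ℕ) :
    y ^ i * x ^ j * z ^ l ∈ monomialSpan k x y z :=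
  Submodule.subset_span ⟨(i, j, l), rfl⟩

theorem mul_mem_monomialSpan {x y z v : T}
    (hv : ∀ i j l, v * (y ^ i * x ^ j * z ^ l) ∈ monomialSpan k x y z) {w : T}
    (hw : w ∈ monomialSpan k x y z) : v * w ∈ monomialSpan k x y z := by
  have : monomialSpan k x y z ≤ (monomialSpan k x y z).comap (LinearMap.mulLeft k v) := by
    refine Submodule.span_le.2 ?_
    rintro _ ⟨⟨i, j, l⟩, rfl⟩
    exact hv i j l
  exact this hw

theorem y_mul_mem_monomialSpan {x y z w : T} (hw : w ∈ monomialSpan k x y z) :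
    y * w ∈ monomialSpan k x y z :=
  mul_mem_monomialSpan (fun i j l => by
    simpa only [pow_succ', mul_assoc] using monomial_mem_monomialSpan x y z (i + 1) j l) hw

theorem x_mul_mem_monomialSpan {x y z w : T} (hxy : x * y = y * x)
    (hw : w ∈ monomialSpan k x y z) : x * w ∈ monomialSpan k x y z :=
  mul_mem_monomialSpan (fun i j l => by
    have h : x * y ^ i = y ^ i * x := Commute.pow_right hxy i
    have := monomial_mem_monomialSpan (k := k) x y z i (j + 1) l
    rwa [pow_succ', ← mul_assoc (y ^ i), ← h, mul_assoc x, mul_assoc x] at this) hw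

theorem u_mul_mem_monomialSpan {x y z u : T} {α β γ δ : k} (hxy : x * y = y * x)
    (hz : z = u + x + α • y) (huu : u * u = γ • (y * y))
    (huy : u * y + y * u = x * x + β • (x * y) + δ • (y * y)) {w : T}
    (hw : w ∈ monomialSpan k x y z) : u * w ∈ monomialSpan k x y z := by
  set W := monomialSpan k x y z
  have hY : ∀ {w}, w ∈ W → y * w ∈ W := y_mul_mem_monomialSpan
  have hX : ∀ {w}, w ∈ W → x * w ∈ W := x_mul_mem_monomialSpan hxy
  have hmon : ∀ i j l, y ^ i * x ^ j * z ^ l ∈ W := monomial_mem_monomialSpan x y z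
  have hcomm : Commute (u * y + y * u) y := by
    have h : Commute x y := hxy
    rw [huy]
    exact ((h.mul_left h).add_left ((h.mul_left (Commute.refl y)).smul_left β)).add_left
      (((Commute.refl y).mul_left (Commute.refl y)).smul_left δ)
  have hyy : u * (y * y) = y * y * u := by
    have h := hcomm.eq
    simp only [add_mul, mul_add, mul_assoc] at h ⊢
    rw [add_comm] at h
    exact add_left_cancel h
  have hq : u * (u * y + y * u) = (u * y + y * u) * u := by
    rw [mul_add, add_mul, ← mul_assoc u u, huu, mul_assoc y u u, huu, smul_mul_assoc,
      mul_smul_comm, ← mul_assoc u y u, mul_assoc y y y, add_comm]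
  have hxx : u * (x * x) = (x * x + β • (x * y)) * u - β • (u * (y * x)) := by
    rw [huy, mul_add, mul_add, add_mul _ _ u, mul_smul_comm, mul_smul_comm, smul_mul_assoc δ,
      hyy, hxy] at hq
    rw [hxy]
    exact eq_sub_of_add_eq (add_right_cancel hq)
  have stepY : ∀ w ∈ W, u * w ∈ W → u * (y * w) ∈ W := by
    intro w hw huw
    have : u * (y * w) = x * (x * w) + β • (x * (y * w)) + δ • (y * (y * w)) - y * (u * w) := by
      rw [← mul_assoc, eq_sub_of_add_eq huy]
      simp only [sub_mul, add_mul, smul_mul_assoc, mul_assoc]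
    rw [this]
    exact W.sub_mem (W.add_mem (W.add_mem (hX (hX hw)) (W.smul_mem _ (hX (hY hw))))
      (W.smul_mem _ (hY (hY hw)))) (hY huw)
  have hz_pow : ∀ l, u * z ^ l ∈ W := by
    intro l
    have h : u * z ^ l = z ^ (l + 1) - α • (y * z ^ l) - x * z ^ l := by
      rw [pow_succ', eq_sub_of_add_eq (eq_sub_of_add_eq hz.symm)]
      simp only [sub_mul, smul_mul_assoc]
    have hl : ∀ l, z ^ l ∈ W := fun l => by simpa using hmon 0 0 l
    rw [h]
    exact W.sub_mem (W.sub_mem (hl _) (W.smul_mem _ (hY (hl l)))) (hX (hl l))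
  have hxz_pow : ∀ j l, u * (x ^ j * z ^ l) ∈ W := by
    intro j l
    have hl : ∀ j l, x ^ j * z ^ l ∈ W := fun j l => by simpa using hmon 0 j l
    have hl₀ : ∀ l, z ^ l ∈ W := fun l => by simpa using hmon 0 0 l
    induction j using Nat.strong_induction_on with
    | _ j ih =>
      match j, ih with
      | 0, _ => simpa using hz_pow l
      | 1, _ =>
        have h : u * (x ^ 1 * z ^ l) =
            u * z ^ (l + 1) - α • (u * (y * z ^ l)) - γ • (y * (y * z ^ l)) := by
          have hux : u * x = u * z - α • (u * y) - u * u := by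
            rw [hz, mul_add, mul_add, mul_smul_comm]
            abel
          rw [pow_one, ← mul_assoc, hux, huu, pow_succ']
          simp only [sub_mul, smul_mul_assoc, mul_assoc]
        rw [h]
        exact W.sub_mem (W.sub_mem (hz_pow _) (W.smul_mem _ (stepY _ (hl₀ l) (hz_pow l))))
          (W.smul_mem _ (hY (hY (hl₀ l))))
      | j + 2, ih =>
        have h : u * (x ^ (j + 2) * z ^ l) = x * (x * (u * (x ^ j * z ^ l))) +
            β • (x * (y * (u * (x ^ j * z ^ l)))) -
            β • (u * (y * (x ^ (j + 1) * z ^ l))) := by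
          rw [pow_succ' x (j + 1), pow_succ' x j, ← mul_assoc x x, mul_assoc (x * x),
            ← mul_assoc u, hxx]
          simp only [sub_mul, add_mul, smul_mul_assoc, mul_assoc]
        have h0 := ih j (by omega)
        have h1 := ih (j + 1) (by omega)
        rw [h]
        exact W.sub_mem (W.add_mem (hX (hX h0)) (W.smul_mem _ (hX (hY h0))))
          (W.smul_mem _ (stepY _ (hl _ _) h1))
  refine mul_mem_monomialSpan (fun i j l => ?_) hw
  induction i with
  | zero => simpa using hxz_pow j l
  | succ i ih =>
    have := stepY _ (hmon i j l) ih
    simpa only [pow_succ', mul_assoc] using this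

end Spanning

section MainTheorem

variable {k : Type*} [Field k]

theorem Tx_mul_Ty (a b c d e f A B C D E F : k) :
    Tx k a b c d e f A B C D E F * Ty k a b c d e f A B C D E F =
      Ty k a b c d e f A B C D E F * Tx k a b c d e f A B C D E F := by
  simpa [Tx, Ty] using RingQuot.mkAlgHom_rel k
    (show Trel k a b c d e f A B C D E F _ _ from Or.inl ⟨rfl, rfl⟩)

theorem Tz_mul_Tx (a b c d e f A B C D E F : k) :
    Tz k a b c d e f A B C D E F * Tx k a b c d e f A B C D E F =
      a • Tx k a b c d e f A B C D E F ^ 2 +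
      b • (Tx k a b c d e f A B C D E F * Ty k a b c d e f A B C D E F) +
      c • Ty k a b c d e f A B C D E F ^ 2 +
      d • (Tx k a b c d e f A B C D E F * Tz k a b c d e f A B C D E F) +
      e • (Ty k a b c d e f A B C D E F * Tz k a b c d e f A B C D E F) +
      f • Tz k a b c d e f A B C D E F ^ 2 := by
  simpa [Tx, Ty, Tz] using RingQuot.mkAlgHom_rel k
    (show Trel k a b c d e f A B C D E F _ _ from Or.inr (Or.inl ⟨rfl, rfl⟩))

theorem Tz_mul_Ty (a b c d e f A B C D E F : k) :
    Tz k a b c d e f A B C D E F * Ty k a b c d e f A B C D E F =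
      A • Tx k a b c d e f A B C D E F ^ 2 +
      B • (Tx k a b c d e f A B C D E F * Ty k a b c d e f A B C D E F) +
      C • Ty k a b c d e f A B C D E F ^ 2 +
      D • (Tx k a b c d e f A B C D E F * Tz k a b c d e f A B C D E F) +
      E • (Ty k a b c d e f A B C D E F * Tz k a b c d e f A B C D E F) +
      F • Tz k a b c d e f A B C D E F ^ 2 := by
  simpa [Tx, Ty, Tz] using RingQuot.mkAlgHom_rel k
    (show Trel k a b c d e f A B C D E F _ _ from Or.inr (Or.inr ⟨rfl, rfl⟩))

/-- A subspace of `T` containing `1` and stable under left multiplication by the generators is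
everything. -/
theorem eq_top_of_mul_mem {a b c d e f A B C D E F : k}
    {W : Submodule k (Talg k a b c d e f A B C D E F)} (h1 : 1 ∈ W)
    (hx : ∀ w ∈ W, Tx k a b c d e f A B C D E F * w ∈ W)
    (hy : ∀ w ∈ W, Ty k a b c d e f A B C D E F * w ∈ W)
    (hz : ∀ w ∈ W, Tz k a b c d e f A B C D E F * w ∈ W) : W = ⊤ := by
  have key : ∀ v : FreeAlgebra k (Fin 3), ∀ w ∈ W,
      RingQuot.mkAlgHom k (Trel k a b c d e f A B C D E F) v * w ∈ W := by
    intro v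
    induction v using FreeAlgebra.induction with
    | grade0 r =>
      intro w hw
      rw [AlgHom.commutes, ← Algebra.smul_def]
      exact W.smul_mem _ hw
    | grade1 i =>
      fin_cases i
      exacts [hx, hy, hz]
    | mul v₁ v₂ h₁ h₂ =>
      intro w hw
      rw [map_mul, mul_assoc]
      exact h₁ _ (h₂ _ hw)
    | add v₁ v₂ h₁ h₂ =>
      intro w hw
      rw [map_add, add_mul]
      exact W.add_mem (h₁ _ hw) (h₂ _ hw)
  refine eq_top_iff.2 fun v _ => ?_
  obtain ⟨v, rfl⟩ := RingQuot.mkAlgHom_surjective k _ v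
  simpa using key v 1 h1

/-- The change of variables `z = u + x + (1 - a) y` turns the defining relations into
`u² = γ y²` and `uy + yu = x² + β xy + δ y²`. -/
theorem relations_iff {T : Type*} [Ring T] [Algebra k T] {x y u z : T} (a c B C : k)
    (hxy : x * y = y * x) (hz : z = u + x + (1 - a) • y) :
    (z * x + x * z = a • x ^ 2 + ((1 - a) * (2 - B)) • (x * y) + c • y ^ 2 + z ^ 2 ∧
      z * y + y * z = x ^ 2 + B • (x * y) + C • y ^ 2) ↔
    (u * u = ((1 - a) ^ 2 - (1 - a) * C - c) • (y * y) ∧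
      u * y + y * u = x * x + (B - 2) • (x * y) + (C - 2 * (1 - a)) • (y * y)) := by
  have h2 : z * y + y * z - (x ^ 2 + B • (x * y) + C • y ^ 2) =
      u * y + y * u - (x * x + (B - 2) • (x * y) + (C - 2 * (1 - a)) • (y * y)) := by
    rw [hz]
    simp only [pow_two, add_mul, mul_add, smul_mul_assoc, mul_smul_comm, hxy]
    module
  have h1 : a • x ^ 2 + ((1 - a) * (2 - B)) • (x * y) + c • y ^ 2 + z ^ 2 - (z * x + x * z) =
      u * u - ((1 - a) ^ 2 - (1 - a) * C - c) • (y * y) + (1 - a) • (u * y + y * u -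
        (x * x + (B - 2) • (x * y) + (C - 2 * (1 - a)) • (y * y))) := by
    rw [hz]
    simp only [pow_two, add_mul, mul_add, smul_mul_assoc, mul_smul_comm, hxy]
    module
  rw [eq_comm, ← sub_eq_zero, h1, ← sub_eq_zero (a := z * y + y * z), h2,
    ← sub_eq_zero (a := u * u), ← sub_eq_zero (a := u * y + y * u)]
  constructor
  · rintro ⟨h, h'⟩
    exact ⟨by simpa [h'] using h, h'⟩
  · rintro ⟨h, h'⟩
    exact ⟨by rw [h, h', smul_zero, add_zero], h'⟩

/-- The monomials `y^i x^j z^l` of `T` are linearly independent as soon as they are so after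
applying an algebra homomorphism that respects the relations. -/
theorem linearIndependent_of_model {a b c d e f A B C D E F : k} {S : Type*} [Ring S]
    [Algebra k S] (x y z : S) (hxy : x * y = y * x)
    (hzx : z * x = a • x ^ 2 + b • (x * y) + c • y ^ 2 + d • (x * z) + e • (y * z) + f • z ^ 2)
    (hzy : z * y = A • x ^ 2 + B • (x * y) + C • y ^ 2 + D • (x * z) + E • (y * z) + F • z ^ 2)
    (hli : LinearIndependent k
      fun p : ℕ × ℕ × ℕ => y ^ p.1 * x ^ p.2.1 * z ^ p.2.2) :
    LinearIndependent k
      fun p : ℕ × ℕ × ℕ =>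
        (Ty k a b c d e f A B C D E F) ^ p.1 * (Tx k a b c d e f A B C D E F) ^ p.2.1 *
          (Tz k a b c d e f A B C D E F) ^ p.2.2 := by
  let F₀ : FreeAlgebra k (Fin 3) →ₐ[k] S := FreeAlgebra.lift k ![x, y, z]
  have hX : F₀ (Xf k) = x := by simp [F₀, Xf]
  have hY : F₀ (Yf k) = y := by simp [F₀, Yf]
  have hZ : F₀ (Zf k) = z := by simp [F₀, Zf]
  let G : Talg k a b c d e f A B C D E F →ₐ[k] S := RingQuot.liftAlgHom k ⟨F₀, by
    rintro m n (⟨rfl, rfl⟩ | ⟨rfl, rfl⟩ | ⟨rfl, rfl⟩)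
    · simpa [hX, hY] using hxy
    · simpa [hX, hY, hZ] using hzx
    · simpa [hX, hY, hZ] using hzy⟩
  refine LinearIndependent.of_comp G.toLinearMap ?_
  convert hli using 2 with p
  simp [G, Tx, Ty, Tz, hX, hY, hZ]

end MainTheorem

/-- For `T = T(a, (1-a)(2-B), c, -1, 0, 1; 1, B, C, 0, -1, 0)`, the family
`(i,j,l) ↦ y^i x^j z^l` is a `k`-vector-space basis of `T`; in particular `T` is a graded
twisted tensor product of `k[x,y]` and `k[z]` and its Hilbert series is `(1-t)^{-3}`. -/
theorem stmt15 {k : Type*} [Field k] [IsAlgClosed k] (a c B C : k) :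
    ThasBasis k a ((1 - a) * (2 - B)) c (-1) 0 1 1 B C 0 (-1) 0 := by
  set α := 1 - a
  constructor
  · let P := MvPolynomial (Fin 2) k
    let x₀ : P := MvPolynomial.X 0
    let y₀ : P := MvPolynomial.X 1
    let β := B - 2
    let δ := C - 2 * α
    let γ := α ^ 2 - α * C - c
    let s : P := y₀ ^ 2
    let q : P := x₀ ^ 2 + β • (x₀ * y₀) + δ • s
    let r : P := q - δ • s
    have hr : r = x₀ ^ 2 + β • (x₀ * y₀) := add_sub_cancel_right _ _
    let Y : Module.End k (ℕ → P × P × P × P) := wordY s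
    let X : Module.End k (ℕ → P × P × P × P) := wordX β s r
    let Z : Module.End k (ℕ → P × P × P × P) := wordZ α β γ s q r
    have hXY : X * Y = Y * X := wordX_mul_wordY β s r
    obtain ⟨hZX, hZY⟩ := (relations_iff a c B C hXY (z := Z) (u := wordU γ s q) rfl).2
      ⟨wordU_mul_wordU γ s q, wordU_mul_wordY_add β γ δ s q⟩
    refine linearIndependent_of_model (S := (Module.End k (ℕ → P × P × P × P))ᵐᵒᵖ)
      (.op X) (.op Y) (.op Z) (congrArg MulOpposite.op hXY.symm) ?_ ?_ ?_
    · refine MulOpposite.unop_injective ?_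
      have h := eq_sub_of_add_eq' hZX
      simp only [MulOpposite.unop_add, MulOpposite.unop_smul, MulOpposite.unop_mul,
        MulOpposite.unop_pow, MulOpposite.unop_op, h, ← hXY]
      module
    · refine MulOpposite.unop_injective ?_
      have h := eq_sub_of_add_eq' hZY
      simp only [MulOpposite.unop_add, MulOpposite.unop_smul, MulOpposite.unop_mul,
        MulOpposite.unop_pow, MulOpposite.unop_op, h, ← hXY]
      module
    · let v₀ : ℕ → P × P × P × P := Pi.single 0 (1, 0, 0, 0)
      let ev : (Module.End k (ℕ → P × P × P × P))ᵐᵒᵖ →ₗ[k] (ℕ → P × P × P × P) :=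
        LinearMap.applyₗ v₀ ∘ₗ (MulOpposite.opLinearEquiv k).symm.toLinearMap
      choose θ hθ using exists_leftInverse_wordZ_pow α β γ s q r
      have hev : ∀ i j l, ev (.op Y ^ i * .op X ^ j * .op Z ^ l) =
          (Z ^ l) (Pi.single 0 ((fiberX β s r ^ j)
            ((fiberY (k := k) s ^ i) (1, 0, 0, 0)))) := by
        intro i j l
        rw [← wordX_pow_single, ← wordY_pow_single]
        rfl
      refine linearIndependent_of_blockTriangular (fun p => p.2.2)
        (fun l => fiberEval x₀ y₀ ∘ₗ θ l ∘ₗ LinearMap.proj l ∘ₗ ev) ?_ ?_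
      · intro p n hn
        simp only [LinearMap.comp_apply, hev, LinearMap.proj_apply]
        rw [wordZ_pow_apply_eq_zero _ _ _ _ _ _ _ _ _ hn, map_zero, map_zero]
      · intro l
        have hdiag : ∀ p : {p : ℕ × ℕ × ℕ | p.2.2 = l},
            (fiberEval x₀ y₀ ∘ₗ θ l ∘ₗ LinearMap.proj l ∘ₗ ev)
              (.op Y ^ p.1.1 * .op X ^ p.1.2.1 * .op Z ^ p.1.2.2) =
            MvPolynomial.monomial (Finsupp.single 0 p.1.2.1 + Finsupp.single 1 p.1.1) 1 := by
          rintro ⟨⟨i, j, l⟩, rfl⟩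
          simp only [LinearMap.comp_apply, hev, LinearMap.proj_apply]
          rw [hθ, hr, fiberEval_fiberX_pow, fiberEval_fiberY_pow, MvPolynomial.monomial_add_single,
            ← MvPolynomial.X_pow_eq_monomial]
          simp [fiberEval, x₀, y₀]
        rw [LinearIndepOn]
        simp only [hdiag]
        have hbasis := (MvPolynomial.basisMonomials (Fin 2) k).linearIndependent
        rw [MvPolynomial.coe_basisMonomials] at hbasis
        refine hbasis.comp (fun p : {p : ℕ × ℕ × ℕ | p.2.2 = l} =>
          Finsupp.single 0 p.1.2.1 + Finsupp.single 1 p.1.1) ?_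
        rintro ⟨⟨i, j, l⟩, rfl⟩ ⟨⟨i', j', l'⟩, hl⟩ h
        have h0 := DFunLike.congr_fun h 0
        have h1 := DFunLike.congr_fun h 1
        simp only [Finsupp.add_apply, Finsupp.single_apply] at h0 h1
        simp at h0 h1 hl
        simp [h0, h1, hl]
  · set x := Tx k a (α * (2 - B)) c (-1) 0 1 1 B C 0 (-1) 0
    set y := Ty k a (α * (2 - B)) c (-1) 0 1 1 B C 0 (-1) 0
    set z := Tz k a (α * (2 - B)) c (-1) 0 1 1 B C 0 (-1) 0
    have hxy : x * y = y * x := Tx_mul_Ty ..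
    have hzx := Tz_mul_Tx a (α * (2 - B)) c (-1) 0 1 1 B C 0 (-1) 0
    have hzy := Tz_mul_Ty a (α * (2 - B)) c (-1) 0 1 1 B C 0 (-1) 0
    have hz : z = (z - x - α • y) + x + α • y := by abel
    obtain ⟨huu, huy⟩ := (relations_iff a c B C hxy hz).1
      ⟨by rw [hzx]; module, by rw [hzy]; module⟩
    change monomialSpan k x y z = ⊤
    have hX : ∀ w ∈ monomialSpan k x y z, x * w ∈ monomialSpan k x y z :=
      fun _ => x_mul_mem_monomialSpan hxy
    have hY : ∀ w ∈ monomialSpan k x y z, y * w ∈ monomialSpan k x y z :=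
      fun _ => y_mul_mem_monomialSpan
    refine eq_top_of_mul_mem ?_ hX hY fun w hw => ?_
    · simpa using monomial_mem_monomialSpan (k := k) x y z 0 0 0
    · change z * w ∈ _
      rw [hz, add_mul, add_mul, smul_mul_assoc, ← hz]
      exact add_mem (add_mem (u_mul_mem_monomialSpan hxy hz huu huy hw) (hX w hw))
        (Submodule.smul_mem _ _ (hY w hw))
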